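/- arXiv:2510.02107 — 6 statements merged into one kernel-verified Lean document; each statement's English description precedes it below -/
import Mathlib

section
/- Let K ≥ 2 be an integer, (Ω, μ) a probability space, and let Y : Ω → Fin K and F : Ω → (Fin K → ℝ) be measurable maps (F assigns to each sample the vector of model logits at that data point). Fix α > 0, ρ > 0 and γ > 0. Then μ{ω | F ω (Y ω) − max_{j ≠ Y ω} F ω j ≤ γ} ≤ exp(γ·α/(α+1)) · ρ^(−α/(α+1)) · ∫ (exp(−α · F ω (Y ω)) + ρ · ∑_{j} exp(F ω j)) dμ(ω), where the integral is the Lebesgue integral of a nonnegative function with values in [0,∞] and the inequality is understood in [0,∞]. -/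
open MeasureTheory Real

/-- The maximum of the logits over all labels different from `y` (well-defined for `K ≥ 2`). -/
noncomputable def maxOther {K : ℕ} (hK : 2 ≤ K) (v : Fin K → ℝ) (y : Fin K) : ℝ :=
  (Finset.univ.erase y).sup'
    (by
      rw [← Finset.card_pos, Finset.card_erase_of_mem (Finset.mem_univ y),
        Finset.card_univ, Fintype.card_fin]
      omega) v

/-- **Theorem 1 (Margin Maximization).** -/
theorem margin_maximization {K : ℕ} (hK : 2 ≤ K) {Ω : Type*} [MeasurableSpace Ω]
    (μ : Measure Ω) [IsProbabilityMeasure μ]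
    (Y : Ω → Fin K) (F : Ω → Fin K → ℝ) (hY : Measurable Y) (hF : Measurable F)
    (α ρ γ : ℝ) (hα : 0 < α) (hρ : 0 < ρ) (hγ : 0 < γ) :
    μ {ω | F ω (Y ω) - maxOther hK (F ω) (Y ω) ≤ γ} ≤
      ENNReal.ofReal (Real.exp (γ * α / (α + 1)) * ρ ^ (-(α / (α + 1)))) *
        ∫⁻ ω, ENNReal.ofReal
          (Real.exp (-α * F ω (Y ω)) + ρ * ∑ j, Real.exp (F ω j)) ∂μ := by
  have hFY : Measurable fun ω => F ω (Y ω) := by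
    have h : (fun ω => F ω (Y ω)) = fun ω => ∑ j, if Y ω = j then F ω j else 0 := by
      funext ω
      simp
    rw [h]
    refine Finset.measurable_sum _ fun j _ => ?_
    exact Measurable.ite (hY (measurableSet_singleton j)) (measurable_pi_iff.1 hF j)
      measurable_const
  have hFj : ∀ j, Measurable fun ω => F ω j := fun j => measurable_pi_iff.1 hF j
  have hmeas : Measurable fun ω => ENNReal.ofReal
      (Real.exp (-α * F ω (Y ω)) + ρ * ∑ j, Real.exp (F ω j)) := by
    refine ENNReal.measurable_ofReal.comp ?_
    refine ((hFY.const_mul _).exp).add ((Finset.measurable_sum _ fun j _ => (hFj j).exp).const_mul _)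
  rw [← lintegral_const_mul _ hmeas]
  have key := mul_meas_ge_le_lintegral (μ := μ) (hmeas.const_mul
    (ENNReal.ofReal (Real.exp (γ * α / (α + 1)) * ρ ^ (-(α / (α + 1)))))) 1
  rw [one_mul] at key
  refine le_trans (measure_mono ?_) key
  intro ω hω
  simp only [Set.mem_setOf_eq] at hω ⊢
  have hc : Real.exp (γ * α / (α + 1)) * ρ ^ (-(α / (α + 1)))
      = Real.exp (-((Real.log ρ - γ) * (α / (α + 1)))) := by
    rw [Real.rpow_def_of_pos hρ, ← Real.exp_add]
    congr 1
    ring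
  rw [hc, ← ENNReal.ofReal_mul (Real.exp_pos _).le, ENNReal.one_le_ofReal, Real.exp_neg,
    inv_mul_eq_div, one_le_div (Real.exp_pos _)]
  obtain ⟨k, -, hk⟩ := Finset.exists_mem_eq_sup' (s := Finset.univ.erase (Y ω))
    (by
      rw [← Finset.card_pos, Finset.card_erase_of_mem (Finset.mem_univ _),
        Finset.card_univ, Fintype.card_fin]
      omega) (F ω)
  have hk' : F ω (Y ω) - F ω k ≤ γ := by
    unfold maxOther at hω
    rwa [hk] at hω
  have hs : Real.exp (F ω k) ≤ ∑ j, Real.exp (F ω j) :=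
    Finset.single_le_sum (f := fun j => Real.exp (F ω j)) (fun j _ => (Real.exp_pos _).le)
      (Finset.mem_univ k)
  have hs' := mul_le_mul_of_nonneg_left hs hρ.le
  have hb := Real.exp_pos (-α * F ω (Y ω))
  have hd := mul_pos hρ (Real.exp_pos (F ω k))
  have e : ρ * Real.exp (F ω k) = Real.exp (Real.log ρ + F ω k) := by
    rw [Real.exp_add, Real.exp_log hρ]
  have h1 : (0:ℝ) < α + 1 := by linarith
  have hβ : α / (α + 1) * (α + 1) = α := div_mul_cancel₀ _ h1.ne'
  rcases le_total ((Real.log ρ - γ) * (α / (α + 1))) (-α * F ω (Y ω)) with h | h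
  · have := Real.exp_le_exp.2 h
    linarith
  · have h2 : (Real.log ρ - γ) * (α / (α + 1)) ≤ Real.log ρ + F ω k := by
      have h3 : -F ω (Y ω) ≤ (Real.log ρ - γ) / (α + 1) := by
        refine le_of_mul_le_mul_left ?_ hα
        calc α * -F ω (Y ω) = -α * F ω (Y ω) := by ring
          _ ≤ _ := h
          _ = _ := by ring
      have h4 : (Real.log ρ - γ) * (α / (α + 1))
          = (Real.log ρ - γ) - (Real.log ρ - γ) / (α + 1) := by
        field_simp
        ring
      linarith
    have := Real.exp_le_exp.2 h2
    linarith
end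

section
/- Let K ≥ 1 be an integer, X a measurable space, μ a probability measure on X, and κ a Markov kernel from X to Fin K such that κ(x)({y}) > 0 for every x ∈ X and y : Fin K. Fix α > 0 and ρ > 0. For a measurable function f : X → (Fin K → ℝ) define the population penalized exponential loss E(f) = ∫_X (∑_{y} κ(x)({y}) · exp(−α · f(x) y) + ρ · ∑_{j} exp(f(x) j)) dμ(x), valued in [0,∞]. Define f_* : X → (Fin K → ℝ) by f_*(x) y = (1+α)⁻¹ · log(α · κ(x)({y}) / ρ). Then f_* is measurable and for every measurable f : X → (Fin K → ℝ) one has E(f_*) ≤ E(f). -/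
open MeasureTheory ProbabilityTheory Real

theorem penex_scalar (α ρ p t : ℝ) (hα : 0 < α) (hρ : 0 < ρ) (hp : 0 < p) :
    p * Real.exp (-α * ((1 + α)⁻¹ * Real.log (α * p / ρ))) +
      ρ * Real.exp ((1 + α)⁻¹ * Real.log (α * p / ρ)) ≤
    p * Real.exp (-α * t) + ρ * Real.exp t := by
  set s := (1 + α)⁻¹ * Real.log (α * p / ρ) with hs
  have h1 : (1 + α) * s = Real.log (α * p / ρ) := by
    rw [hs]; field_simp
  have h2 : Real.exp s = Real.exp (-α * s) * (α * p / ρ) := by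
    rw [← Real.exp_log (show 0 < α * p / ρ by positivity), ← h1, ← Real.exp_add]
    congr 1; ring
  have h3 : ρ * Real.exp s = α * (p * Real.exp (-α * s)) := by
    rw [h2]; field_simp
  have h4 : Real.exp (-α * t) = Real.exp (-α * s) * Real.exp (-α * (t - s)) := by
    rw [← Real.exp_add]; congr 1; ring
  have h5 : Real.exp t = Real.exp s * Real.exp (t - s) := by
    rw [← Real.exp_add]; congr 1; ring
  have h6 := mul_le_mul_of_nonneg_left (Real.add_one_le_exp (-α * (t - s)))
    (show 0 ≤ p * Real.exp (-α * s) by positivity)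
  have h7 := mul_le_mul_of_nonneg_left (Real.add_one_le_exp (t - s))
    (show 0 ≤ ρ * Real.exp s by positivity)
  have h8 : ρ * Real.exp s * (t - s) = α * (p * Real.exp (-α * s)) * (t - s) := by rw [h3]
  rw [h4, h5]
  linarith

/-- **Proposition 1 (Fisher Consistency), minimization half, population level.**
The function `f_* x y = (1+α)⁻¹ log (α P(y|x) / ρ)` is measurable and minimizes the
population penalized exponential loss. -/
theorem penex_population_minimizer {K : ℕ} (hK : 1 ≤ K) {X : Type*} [MeasurableSpace X]
    (μ : Measure X) [IsProbabilityMeasure μ]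
    (κ : Kernel X (Fin K)) [IsMarkovKernel κ]
    (hκ : ∀ (x : X) (y : Fin K), 0 < κ x {y})
    (α ρ : ℝ) (hα : 0 < α) (hρ : 0 < ρ) :
    Measurable (fun x (y : Fin K) => (1 + α)⁻¹ * Real.log (α * (κ x {y}).toReal / ρ)) ∧
      ∀ f : X → Fin K → ℝ, Measurable f →
        (∫⁻ x, ((∑ y, κ x {y} *
              ENNReal.ofReal (Real.exp (-α * ((1 + α)⁻¹ * Real.log (α * (κ x {y}).toReal / ρ))))) +
            ENNReal.ofReal ρ *
              ∑ j, ENNReal.ofReal (Real.exp ((1 + α)⁻¹ * Real.log (α * (κ x {j}).toReal / ρ)))) ∂μ)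
        ≤
        ∫⁻ x, ((∑ y, κ x {y} * ENNReal.ofReal (Real.exp (-α * f x y))) +
            ENNReal.ofReal ρ * ∑ j, ENNReal.ofReal (Real.exp (f x j))) ∂μ := by
  refine ⟨?_, fun f _ => lintegral_mono fun x => ?_⟩
  · refine measurable_pi_lambda _ fun y => ?_
    have h : Measurable fun x => κ x {y} := κ.measurable_coe (measurableSet_singleton y)
    exact (Real.measurable_log.comp ((h.ennreal_toReal.const_mul α).div_const ρ)).const_mul _
  · simp only [Finset.mul_sum, ← Finset.sum_add_distrib]
    refine Finset.sum_le_sum fun y _ => ?_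
    have hp : 0 < (κ x {y}).toReal := ENNReal.toReal_pos (hκ x y).ne' (measure_ne_top _ _)
    have key : ∀ u : ℝ, κ x {y} * ENNReal.ofReal (Real.exp (-α * u)) +
        ENNReal.ofReal ρ * ENNReal.ofReal (Real.exp u) =
        ENNReal.ofReal ((κ x {y}).toReal * Real.exp (-α * u) + ρ * Real.exp u) := by
      intro u
      rw [ENNReal.ofReal_add (by positivity) (by positivity), ENNReal.ofReal_mul hp.le,
        ENNReal.ofReal_mul hρ.le, ENNReal.ofReal_toReal (measure_ne_top _ _)]
    rw [key, key]
    exact ENNReal.ofReal_le_ofReal (penex_scalar α ρ _ _ hα hρ hp)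
end

section
/- Let K ≥ 1 be an integer, α > 0, ρ > 0, and let p : Fin K → ℝ be a probability vector with p y > 0 for all y. Define v_* : Fin K → ℝ by v_* y = (1+α)⁻¹ · log(α · p y / ρ). Then v_* is the unique global minimizer of the conditional penalized exponential loss L_p: for every v : Fin K → ℝ with v ≠ v_*, L_p(v_*) < L_p(v). -/
open Real

lemma penex_scalar_s3 (α ρ q s v : ℝ) (hα : 0 < α) (hρ : 0 < ρ) (hq : 0 < q)
    (hs : s = (1 + α)⁻¹ * Real.log (α * q / ρ)) (hv : v ≠ s) :
    q * Real.exp (-α * s) + ρ * Real.exp s < q * Real.exp (-α * v) + ρ * Real.exp v := by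
  have h1 : (1 + α) * s = Real.log (α * q / ρ) := by
    rw [hs]; field_simp
  have h2 : Real.exp s = α * q / ρ * Real.exp (-α * s) := by
    have h3 : Real.exp (Real.log (α * q / ρ)) = α * q / ρ := Real.exp_log (by positivity)
    rw [← h3, ← h1, ← Real.exp_add]; congr 1; ring
  have h4 : ρ * Real.exp s = α * (q * Real.exp (-α * s)) := by
    rw [h2]; field_simp
  have hd : v - s ≠ 0 := sub_ne_zero.mpr hv
  have e1 : Real.exp (-α * v) = Real.exp (-α * s) * Real.exp (-α * (v - s)) := by
    rw [← Real.exp_add]; congr 1; ring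
  have e2 : Real.exp v = Real.exp s * Real.exp (v - s) := by
    rw [← Real.exp_add]; congr 1; ring
  have i1 := Real.add_one_lt_exp (mul_ne_zero (neg_ne_zero.mpr hα.ne') hd)
  have i2 := Real.add_one_lt_exp hd
  have j1 := mul_lt_mul_of_pos_left i1 (mul_pos hq (Real.exp_pos (-α * s)))
  have j2 := mul_lt_mul_of_pos_left i2 (mul_pos hρ (Real.exp_pos s))
  have h5 : ρ * Real.exp s * (v - s) = α * (q * Real.exp (-α * s)) * (v - s) := by rw [h4]
  rw [e1, e2]
  linarith

/-- **Step 1 in the proof of Proposition 1 (Fisher Consistency).**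
`v_* y = (1+α)⁻¹ log (α p y / ρ)` is the unique global minimizer of the conditional
penalized exponential loss `L_p(v) = ∑ y, p y * exp (-α v y) + ρ * ∑ j, exp (v j)`. -/
theorem penex_conditional_unique_minimizer {K : ℕ} (hK : 1 ≤ K) (α ρ : ℝ)
    (hα : 0 < α) (hρ : 0 < ρ)
    (p : Fin K → ℝ) (hp : ∀ y, 0 < p y) (hsum : ∑ y, p y = 1) :
    ∀ v : Fin K → ℝ, v ≠ (fun y => (1 + α)⁻¹ * Real.log (α * p y / ρ)) →
      ((∑ y, p y * Real.exp (-α * ((1 + α)⁻¹ * Real.log (α * p y / ρ)))) +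
          ρ * ∑ j, Real.exp ((1 + α)⁻¹ * Real.log (α * p j / ρ)))
        <
      (∑ y, p y * Real.exp (-α * v y)) + ρ * ∑ j, Real.exp (v j) := by
  intro v hv
  obtain ⟨y, hy⟩ := Function.ne_iff.mp hv
  rw [Finset.mul_sum, Finset.mul_sum, ← Finset.sum_add_distrib, ← Finset.sum_add_distrib]
  apply Finset.sum_lt_sum
  · intro i _
    by_cases h : v i = (1 + α)⁻¹ * Real.log (α * p i / ρ)
    · rw [h]
    · exact (penex_scalar_s3 α ρ (p i) _ (v i) hα hρ (hp i) rfl h).le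
  · exact ⟨y, Finset.mem_univ y, penex_scalar_s3 α ρ (p y) _ (v y) hα hρ (hp y) rfl hy⟩
end

section
/- Let K ≥ 2 be an integer, λ > 0, and let p : Fin K → ℝ be a probability vector with p y > 0 for all y that is not uniform (i.e., there exist y₁, y₂ with p y₁ ≠ p y₂). Define, on the open probability simplex Δ° = {q : Fin K → ℝ | q y > 0 for all y and ∑_y q y = 1}, the confidence-penalized cross-entropy L(q) = −∑_{y} p y · log(q y) + λ · ∑_{y} q y · log(q y). Then p is not a minimizer of L over Δ°: there exists q ∈ Δ° with L(q) < L(p). -/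
open Real

/-- **Observation 1 (confidence penalty breaks Fisher consistency).**
If `p` is a non-uniform probability vector with positive entries and `λ > 0`, then `p` is
not a minimizer over the open simplex of the confidence-penalized cross-entropy
`L(q) = −∑ y, p y * log (q y) + λ * ∑ y, q y * log (q y)`. -/
theorem confidence_penalty_not_fisher_consistent {K : ℕ} (hK : 2 ≤ K) (lam : ℝ)
    (hlam : 0 < lam) (p : Fin K → ℝ) (hp : ∀ y, 0 < p y) (hsum : ∑ y, p y = 1)
    (hnonunif : ∃ y₁ y₂ : Fin K, p y₁ ≠ p y₂) :
    ∃ q : Fin K → ℝ, (∀ y, 0 < q y) ∧ (∑ y, q y = 1) ∧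
      (-∑ y, p y * Real.log (q y)) + lam * ∑ y, q y * Real.log (q y) <
        (-∑ y, p y * Real.log (p y)) + lam * ∑ y, p y * Real.log (p y) := by
  by_contra hcon
  push Not at hcon
  obtain ⟨a, b, hab⟩ := hnonunif
  let d : Fin K → ℝ := fun y => (if y = b then 1 else 0) - (if y = a then 1 else 0)
  have hd : ∑ y, d y = 0 := by simp [d, Finset.sum_sub_distrib]
  have hlin : ∀ y, HasDerivAt (fun t : ℝ => p y + t * d y) (d y) 0 := fun y => by
    simpa using ((hasDerivAt_id (0 : ℝ)).mul_const (d y)).const_add (p y)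
  have hlog : ∀ y, HasDerivAt (fun t : ℝ => Real.log (p y + t * d y)) (d y / p y) 0 := fun y => by
    simpa using (hlin y).log (by simpa using (hp y).ne')
  have h1 : HasDerivAt (fun t : ℝ => ∑ y, p y * Real.log (p y + t * d y))
      (∑ y, p y * (d y / p y)) 0 :=
    HasDerivAt.fun_sum fun y _ => (hlog y).const_mul (p y)
  have h2 : HasDerivAt (fun t : ℝ => ∑ y, (p y + t * d y) * Real.log (p y + t * d y))
      (∑ y, (d y * Real.log (p y) + p y * (d y / p y))) 0 :=
    HasDerivAt.fun_sum fun y _ => by simpa using (hlin y).fun_mul (hlog y)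
  have h3 := h1.fun_neg.fun_add (h2.const_mul lam)
  have hmin : IsLocalMin (fun t : ℝ => -(∑ y, p y * Real.log (p y + t * d y)) +
      lam * ∑ y, (p y + t * d y) * Real.log (p y + t * d y)) 0 := by
    have hev : ∀ᶠ t in nhds (0 : ℝ), ∀ y, 0 < p y + t * d y := by
      rw [Filter.eventually_all]
      intro y
      exact (hlin y).continuousAt.eventually (lt_mem_nhds (by simpa using hp y))
    filter_upwards [hev] with t ht
    have := hcon (fun y => p y + t * d y) ht
      (by rw [Finset.sum_add_distrib, ← Finset.mul_sum, hd, hsum]; simp)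
    simpa using this
  have h4 := hmin.hasDerivAt_eq_zero h3
  have h5 : ∀ y, p y * (d y / p y) = d y := fun y => mul_div_cancel₀ (d y) (hp y).ne'
  simp only [h5, Finset.sum_add_distrib, hd] at h4
  have h6 : ∑ y, d y * Real.log (p y) = Real.log (p b) - Real.log (p a) := by
    simp [d, sub_mul, Finset.sum_sub_distrib]
  rw [h6] at h4
  have h7 : Real.log (p a) = Real.log (p b) := by
    have : lam * (Real.log (p b) - Real.log (p a)) = 0 := by linarith
    rcases mul_eq_zero.mp this with h | h <;> linarith
  exact hab (Real.log_injOn_pos (hp a) (hp b) h7)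
end

section
/- Let n ≥ 2 and let c, a be linearly independent vectors in the Euclidean space ℝⁿ (with the standard inner product ⟨·,·⟩ and norm ‖·‖). Suppose u_* ∈ ℝⁿ satisfies ‖u_*‖ = 1, ⟨a, u_*⟩ ≤ 0, and ⟨c, u_*⟩ ≤ ⟨c, u⟩ for every u ∈ ℝⁿ with ‖u‖ = 1 and ⟨a, u⟩ ≤ 0. Then there exists λ ≥ 0 such that u_* = −(c + λ·a)/‖c + λ·a‖ (note c + λ·a ≠ 0 by linear independence). -/
open RealInnerProductSpace

/-- **Core of Proposition 3 (gradient descent on PENEX is implicit AdaBoost).**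
A minimizer of the linear objective `⟪c, ·⟫` over the unit sphere intersected with the
half-space `⟪a, ·⟫ ≤ 0` is proportional to `−(c + λ a)` for some KKT multiplier `λ ≥ 0`. -/
theorem kkt_sphere_halfspace {n : ℕ} (hn : 2 ≤ n)
    (c a : EuclideanSpace ℝ (Fin n)) (hli : LinearIndependent ℝ ![c, a])
    (ustar : EuclideanSpace ℝ (Fin n)) (hnorm : ‖ustar‖ = 1) (hfeas : ⟪a, ustar⟫ ≤ 0)
    (hopt : ∀ u : EuclideanSpace ℝ (Fin n), ‖u‖ = 1 → ⟪a, u⟫ ≤ 0 → ⟪c, ustar⟫ ≤ ⟪c, u⟫) :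
    ∃ lam : ℝ, 0 ≤ lam ∧ ustar = -(‖c + lam • a‖⁻¹ • (c + lam • a)) := by
  have ha : a ≠ 0 := by
    have := hli.ne_zero 1
    simpa using this
  have hne : ∀ l : ℝ, c + l • a ≠ 0 := by
    intro l hl
    have h := LinearIndependent.pair_iff.mp hli 1 l (by simpa using hl)
    exact one_ne_zero h.1
  have haa : 0 < ⟪a, a⟫ := real_inner_self_pos.mpr ha
  obtain ⟨l, hl0, hw, hc⟩ : ∃ l : ℝ, 0 ≤ l ∧ 0 ≤ ⟪a, c + l • a⟫ ∧ l * ⟪a, c + l • a⟫ = 0 := by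
    rcases le_total 0 ⟪a, c⟫ with h | h
    · exact ⟨0, le_refl _, by simpa using h, by simp⟩
    · have h0 : ⟪a, c + (-⟪a, c⟫ / ⟪a, a⟫) • a⟫ = 0 := by
        rw [inner_add_right, real_inner_smul_right, div_mul_cancel₀ _ haa.ne']
        ring
      exact ⟨-⟪a, c⟫ / ⟪a, a⟫, div_nonneg (by linarith) haa.le, h0.ge, by rw [h0, mul_zero]⟩
  refine ⟨l, hl0, ?_⟩
  have hwne := hne l
  have hcw : c = (c + l • a) - l • a := by abel
  generalize c + l • a = w at *
  have hwn : 0 < ‖w‖ := norm_pos_iff.mpr hwne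
  have hv : ‖-(‖w‖⁻¹ • w)‖ = 1 := by
    rw [norm_neg, norm_smul, norm_inv, norm_norm, inv_mul_cancel₀ hwn.ne']
  have hopt' := hopt (-(‖w‖⁻¹ • w)) hv (by
    rw [inner_neg_right, real_inner_smul_right]
    have := mul_nonneg (inv_nonneg.mpr hwn.le) hw
    linarith)
  rw [hcw, inner_sub_left, inner_sub_left, real_inner_smul_left, real_inner_smul_left,
    inner_neg_right, inner_neg_right, real_inner_smul_right, real_inner_smul_right,
    real_inner_self_eq_norm_sq] at hopt'
  have h1 : ‖w‖⁻¹ * ‖w‖ ^ 2 = ‖w‖ := by field_simp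
  have h2 : l * -(‖w‖⁻¹ * ⟪a, w⟫) = 0 := by
    linear_combination (-‖w‖⁻¹) * hc
  have h3 : l * ⟪a, ustar⟫ ≤ 0 := mul_nonpos_of_nonneg_of_nonpos hl0 hfeas
  have h4 : ⟪w, ustar⟫ ≤ -‖w‖ := by linarith
  have h5 : ‖w‖⁻¹ * ⟪w, ustar⟫ ≤ -1 := by
    have := mul_le_mul_of_nonneg_left h4 (inv_nonneg.mpr hwn.le)
    rwa [mul_neg, inv_mul_cancel₀ hwn.ne'] at this
  have h6 := norm_sub_sq_real ustar (-(‖w‖⁻¹ • w))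
  rw [hv, hnorm, inner_neg_right, real_inner_smul_right, real_inner_comm] at h6
  have h7 : ‖ustar - -(‖w‖⁻¹ • w)‖ ^ 2 = 0 :=
    le_antisymm (by linarith) (sq_nonneg _)
  exact sub_eq_zero.mp (norm_eq_zero.mp (pow_eq_zero_iff two_ne_zero |>.mp h7))
end

section
/- Let K ≥ 2 be an integer, (Ω, μ) a probability space, and let Y : Ω → Fin K and F : Ω → (Fin K → ℝ) be measurable. Let β ∈ (0,1), set α = β/(1−β), and let γ > 0. Then μ{ω | F ω (Y ω) − max_{j ≠ Y ω} F ω j ≤ γ} ≤ exp(β·γ) · (∫ exp(−α · F ω (Y ω)) dμ(ω))^(1−β) · (∫ ∑_{j} exp(F ω j) dμ(ω))^β, where the integrals are Lebesgue integrals of nonnegative functions with values in [0,∞] and the inequality is understood in [0,∞]. -/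
open MeasureTheory Real

/-- **Intermediate product-form bound** in the proof of Theorem 1 (Margin Maximization),
just before the weighted AM–GM step. -/
theorem margin_product_bound {K : ℕ} (hK : 2 ≤ K) {Ω : Type*} [MeasurableSpace Ω]
    (μ : Measure Ω) [IsProbabilityMeasure μ]
    (Y : Ω → Fin K) (F : Ω → Fin K → ℝ) (hY : Measurable Y) (hF : Measurable F)
    (β : ℝ) (hβ : β ∈ Set.Ioo (0 : ℝ) 1) (γ : ℝ) (hγ : 0 < γ) :
    μ {ω | F ω (Y ω) - maxOther hK (F ω) (Y ω) ≤ γ} ≤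
      ENNReal.ofReal (Real.exp (β * γ)) *
        ((∫⁻ ω, ENNReal.ofReal (Real.exp (-(β / (1 - β)) * F ω (Y ω))) ∂μ) ^ (1 - β) *
          (∫⁻ ω, ENNReal.ofReal (∑ j, Real.exp (F ω j)) ∂μ) ^ β) := by
  obtain ⟨h0, h1⟩ := hβ
  have h1' : 0 < 1 - β := by linarith
  have hFj : ∀ j, Measurable fun ω => F ω j := fun j => (measurable_pi_apply j).comp hF
  have hFY : Measurable fun ω => F ω (Y ω) := by
    have : (fun ω => F ω (Y ω)) = fun ω => ∑ j, if Y ω = j then F ω j else 0 := by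
      funext ω; simp
    rw [this]
    refine Finset.measurable_sum _ fun j _ => ?_
    exact Measurable.ite (hY (measurableSet_singleton j)) (hFj j) measurable_const
  have hf : Measurable fun ω => ENNReal.ofReal (Real.exp (-(β / (1 - β)) * F ω (Y ω))) :=
    (Real.measurable_exp.comp (hFY.const_mul _)).ennreal_ofReal
  have hg : Measurable fun ω => ENNReal.ofReal (∑ j, Real.exp (F ω j)) :=
    (Finset.measurable_sum _ fun j _ => Real.measurable_exp.comp (hFj j)).ennreal_ofReal
  refine le_trans ?_ (mul_le_mul_right (ENNReal.lintegral_mul_norm_pow_le hf.aemeasurable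
    hg.aemeasurable h1'.le h0.le (by ring)) _)
  have hm : Measurable fun ω => ENNReal.ofReal (Real.exp (-(β / (1 - β)) * F ω (Y ω))) ^ (1 - β) *
      ENNReal.ofReal (∑ j, Real.exp (F ω j)) ^ β := (hf.pow_const (1 - β)).mul (hg.pow_const β)
  rw [← lintegral_const_mul _ hm]
  have hM := mul_meas_ge_le_lintegral (μ := μ)
    (hm.const_mul (ENNReal.ofReal (Real.exp (β * γ)))) 1
  rw [one_mul] at hM
  refine le_trans (measure_mono ?_) hM
  intro ω hω
  simp only [Set.mem_setOf_eq] at hω ⊢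
  obtain ⟨k, hk, hkm⟩ := Finset.exists_mem_eq_sup' (s := Finset.univ.erase (Y ω)) (by
      rw [← Finset.card_pos, Finset.card_erase_of_mem (Finset.mem_univ _),
        Finset.card_univ, Fintype.card_fin]
      omega) (F ω)
  have hkm' : maxOther hK (F ω) (Y ω) = F ω k := hkm
  rw [hkm'] at hω
  have hs : Real.exp (F ω k) ≤ ∑ j, Real.exp (F ω j) :=
    Finset.single_le_sum (f := fun j => Real.exp (F ω j)) (fun j _ => (Real.exp_pos _).le)
      (Finset.mem_univ k)
  have hs0 := (Real.exp_pos (F ω k)).trans_le hs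
  rw [ENNReal.ofReal_rpow_of_pos (Real.exp_pos _), ENNReal.ofReal_rpow_of_pos hs0,
    ← ENNReal.ofReal_mul (Real.rpow_nonneg (Real.exp_pos _).le _),
    ← ENNReal.ofReal_mul (Real.exp_pos _).le, ENNReal.one_le_ofReal]
  have hp : Real.exp (F ω k) ^ β ≤ (∑ j, Real.exp (F ω j)) ^ β :=
    Real.rpow_le_rpow (Real.exp_pos _).le hs h0.le
  calc (1 : ℝ) ≤ Real.exp (β * γ) * (Real.exp (-(β / (1 - β)) * F ω (Y ω)) ^ (1 - β) *
        Real.exp (F ω k) ^ β) := by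
        rw [← Real.exp_mul, ← Real.exp_mul, ← Real.exp_add, ← Real.exp_add, Real.one_le_exp_iff]
        have : -(β / (1 - β)) * F ω (Y ω) * (1 - β) = -β * F ω (Y ω) := by
          field_simp
        rw [this]
        nlinarith
    _ ≤ _ := by gcongr
end
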